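/- arXiv:2003.01032 — 7 statements merged into one kernel-verified Lean document; each statement's English description precedes it below -/
import Mathlib

section
/- Let d ≥ 1 and ε ≥ 0. Let (ρ_a)_{a∈[d]} be density matrices on ℂ^d and (M_a)_{a∈[d]} a d-outcome POVM on ℂ^d such that Re tr(ρ_a M_a) ≥ 1 − ε for every a ∈ [d]. Then ∑_{a=1}^{d} ‖ρ_a‖ ≥ d(1 − 2ε), where ‖·‖ is the operator norm. (Theorem 1, Eq. (1): near-purity of the experimental states.) -/
open Matrix
open scoped ComplexOrder

/-- Operator (spectral) norm of a complex matrix, as the norm of the induced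
map between Euclidean spaces. -/
noncomputable def opNorm {m n : ℕ} (A : Matrix (Fin m) (Fin n) ℂ) : ℝ :=
  ‖LinearMap.toContinuousLinearMap (Matrix.toEuclideanLin A)‖

/-- A density matrix: positive semidefinite with trace one. -/
def IsDensityMatrix {d : ℕ} (ρ : Matrix (Fin d) (Fin d) ℂ) : Prop :=
  ρ.PosSemidef ∧ ρ.trace = 1

theorem re_star_dotProduct_self {d : ℕ} (v : Fin d → ℂ) :
    (star v ⬝ᵥ v).re = ‖WithLp.toLp 2 v‖ ^ 2 := by
  rw [dotProduct_comm, ← EuclideanSpace.inner_toLp_toLp, inner_self_eq_norm_sq_to_K]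
  norm_cast

theorem re_star_dotProduct_mulVec_le_opNorm_mul {d : ℕ} (A : Matrix (Fin d) (Fin d) ℂ)
    (v : Fin d → ℂ) :
    (star v ⬝ᵥ (A *ᵥ v)).re ≤ opNorm A * (star v ⬝ᵥ v).re := by
  rw [re_star_dotProduct_self, dotProduct_comm, ← EuclideanSpace.inner_toLp_toLp]
  calc _ ≤ ‖WithLp.toLp 2 v‖ * ‖WithLp.toLp 2 (A *ᵥ v)‖ := re_inner_le_norm (𝕜 := ℂ) _ _
    _ ≤ ‖WithLp.toLp 2 v‖ * (opNorm A * ‖WithLp.toLp 2 v‖) := by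
      gcongr
      exact (LinearMap.toContinuousLinearMap (Matrix.toEuclideanLin A)).le_opNorm
        (WithLp.toLp 2 v)
    _ = _ := by ring

theorem opNorm_vecMulVec_star_le {d : ℕ} (v : Fin d → ℂ) :
    opNorm (vecMulVec v (star v)) ≤ (star v ⬝ᵥ v).re := by
  rw [re_star_dotProduct_self]
  refine ContinuousLinearMap.opNorm_le_bound _ (by positivity) fun x => ?_
  have hx : LinearMap.toContinuousLinearMap (Matrix.toEuclideanLin (vecMulVec v (star v))) x =
      inner ℂ (WithLp.toLp 2 v) x • WithLp.toLp 2 v := by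
    ext i
    simp [toEuclideanLin, vecMulVec_mulVec, EuclideanSpace.inner_eq_star_dotProduct,
      dotProduct_comm, mul_comm]
  rw [hx, norm_smul]
  calc _ ≤ (‖WithLp.toLp 2 v‖ * ‖x‖) * ‖WithLp.toLp 2 v‖ := by
        gcongr
        exact norm_inner_le_norm _ _
    _ = _ := by ring

theorem opNorm_sum_le {d : ℕ} {ι : Type*} (s : Finset ι) (A : ι → Matrix (Fin d) (Fin d) ℂ) :
    opNorm (∑ i ∈ s, A i) ≤ ∑ i ∈ s, opNorm (A i) := by
  simp only [opNorm, map_sum]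
  exact norm_sum_le _ _

/-- The operator norm of a positive semidefinite matrix is at most its trace. -/
theorem opNorm_le_re_trace {d : ℕ} {A : Matrix (Fin d) (Fin d) ℂ} (hA : A.PosSemidef) :
    opNorm A ≤ A.trace.re := by
  obtain ⟨m, v, rfl⟩ := posSemidef_iff_eq_sum_vecMulVec.1 hA
  rw [trace_sum, Complex.re_sum]
  refine (opNorm_sum_le _ _).trans (Finset.sum_le_sum fun i _ => ?_)
  rw [trace_vecMulVec, dotProduct_comm]
  exact opNorm_vecMulVec_star_le _

/-- Trace duality between the operator norm and positive semidefinite matrices. -/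
theorem re_trace_mul_le_opNorm_mul {d : ℕ} (A : Matrix (Fin d) (Fin d) ℂ)
    {B : Matrix (Fin d) (Fin d) ℂ} (hB : B.PosSemidef) :
    (A * B).trace.re ≤ opNorm A * B.trace.re := by
  obtain ⟨m, v, rfl⟩ := posSemidef_iff_eq_sum_vecMulVec.1 hB
  rw [Finset.mul_sum, trace_sum, trace_sum, Complex.re_sum, Complex.re_sum, Finset.mul_sum]
  refine Finset.sum_le_sum fun i _ => ?_
  rw [mul_vecMulVec, trace_vecMulVec, trace_vecMulVec, dotProduct_comm, dotProduct_comm (v i)]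
  exact re_star_dotProduct_mulVec_le_opNorm_mul _ _

/-- Theorem 1, Eq. (1): near-purity of the experimental states. -/
theorem near_purity_of_states (d : ℕ) (hd : 1 ≤ d) (ε : ℝ) (hε : 0 ≤ ε)
    (ρ M : Fin d → Matrix (Fin d) (Fin d) ℂ)
    (hρ : ∀ a, IsDensityMatrix (ρ a))
    (hMpos : ∀ a, (M a).PosSemidef)
    (hMsum : ∑ a, M a = 1)
    (hcorr : ∀ a, 1 - ε ≤ ((ρ a * M a).trace).re) :
    (d : ℝ) * (1 - 2 * ε) ≤ ∑ a, opNorm (ρ a) := by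
  have hp : ∀ a, opNorm (ρ a) ≤ 1 := fun a => by
    simpa [(hρ a).2] using opNorm_le_re_trace (hρ a).1
  have hpt : ∀ a, 1 - ε ≤ opNorm (ρ a) * (M a).trace.re := fun a =>
    (hcorr a).trans (re_trace_mul_le_opNorm_mul _ (hMpos a))
  have ht : ∀ a, 0 ≤ (M a).trace.re := fun a =>
    (Complex.le_def.1 (hMpos a).trace_nonneg).1
  have htsum : ∑ a, (M a).trace.re = d := by
    rw [← Complex.re_sum, ← trace_sum, hMsum]
    simp
  rcases le_total (1 / 2) ε with h | h
  · have : 0 ≤ ∑ a, opNorm (ρ a) := Finset.sum_nonneg fun a _ => norm_nonneg _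
    have hd' : (0 : ℝ) ≤ d := Nat.cast_nonneg d
    nlinarith
  · have key : ∀ a, (1 - opNorm (ρ a)) * (1 - ε) ≤ (M a).trace.re - (1 - ε) := fun a => by
      have hle : 1 - ε ≤ (M a).trace.re :=
        (hpt a).trans (mul_le_of_le_one_left (ht a) (hp a))
      nlinarith [hpt a, mul_le_mul_of_nonneg_left hle (sub_nonneg.2 (hp a))]
    have hsum := Finset.sum_le_sum fun a (_ : a ∈ Finset.univ) => key a
    rw [← Finset.sum_mul, Finset.sum_sub_distrib, Finset.sum_sub_distrib, htsum] at hsum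
    simp only [Finset.sum_const, Finset.card_univ, Fintype.card_fin, nsmul_eq_mul,
      mul_one] at hsum
    have hnonneg : 0 ≤ ∑ a, (1 - opNorm (ρ a)) :=
      Finset.sum_nonneg fun a _ => sub_nonneg.2 (hp a)
    rw [Finset.sum_sub_distrib] at hnonneg
    simp only [Finset.sum_const, Finset.card_univ, Fintype.card_fin, nsmul_eq_mul,
      mul_one] at hnonneg
    nlinarith
end

section
/- In the prepare-and-measure scenario on ℂ^d with n settings: suppose the target pure states ρ^x_a (a∈[d], x∈[n]) are such that for each x the family (ρ^x_a)_a consists of rank-one orthogonal projections with ∑_a ρ^x_a = I, and suppose the experimental density matrices ρ̃^x_a and experimental d-outcome POVMs (M̃^y_b)_b on ℂ^d satisfy |Re tr(ρ̃^x_a M̃^y_b) − Re tr(ρ^x_a ρ^y_b)| ≤ ε for all a,b∈[d] and x,y∈[n]. Then for all x ≠ x' and a ≠ a', |Re tr(ρ̃^x_a ρ̃^{x'}_{a'}) − Re tr(ρ^x_a ρ^{x'}_{a'})| ≤ ε + √(2ε + d²ε²). (Theorem 1, first bound of Eq. (3): robust certification of state overlaps.) -/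
open Matrix
open scoped ComplexOrder

/-- A pure state: a rank-one orthogonal projection (Hermitian, idempotent, trace one). -/
def IsPureState {d : ℕ} (ρ : Matrix (Fin d) (Fin d) ℂ) : Prop :=
  ρ.IsHermitian ∧ ρ * ρ = ρ ∧ ρ.trace = 1

section SpectralBounds

variable {ι : Type*} [Fintype ι] [DecidableEq ι] {A B : Matrix ι ι ℂ}

/-- The trace of a product, expanded in an eigenbasis of the second factor. -/
theorem Matrix.IsHermitian.re_trace_mul_eq_sum_eigenvalues (hA : A.IsHermitian)
    (B : Matrix ι ι ℂ) :
    (B * A).trace.re = ∑ i, (((hA.eigenvectorUnitary : Matrix ι ι ℂ)ᴴ * B *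
      (hA.eigenvectorUnitary : Matrix ι ι ℂ)) i i).re * hA.eigenvalues i := by
  have h : A = (hA.eigenvectorUnitary : Matrix ι ι ℂ) *
      diagonal (RCLike.ofReal ∘ hA.eigenvalues) *
      (hA.eigenvectorUnitary : Matrix ι ι ℂ)ᴴ := by
    conv_lhs => rw [hA.spectral_theorem, Unitary.conjStarAlgAut_apply]
    rfl
  have h' : (B * A).trace = (((hA.eigenvectorUnitary : Matrix ι ι ℂ)ᴴ * B *
      (hA.eigenvectorUnitary : Matrix ι ι ℂ)) * diagonal (RCLike.ofReal ∘ hA.eigenvalues)).trace := by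
    conv_lhs => rw [h, ← Matrix.mul_assoc, Matrix.trace_mul_comm]
    simp only [Matrix.mul_assoc]
  rw [h', Matrix.trace, Complex.re_sum]
  refine Finset.sum_congr rfl fun i _ => ?_
  rw [Matrix.diag_apply, Matrix.mul_diagonal]
  simp

theorem Matrix.IsHermitian.conj_eigenvectorUnitary_apply_self (hA : A.IsHermitian) (i : ι) :
    (((hA.eigenvectorUnitary : Matrix ι ι ℂ)ᴴ * A *
      (hA.eigenvectorUnitary : Matrix ι ι ℂ)) i i).re = hA.eigenvalues i := by
  have h := hA.conjStarAlgAut_star_eigenvectorUnitary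
  rw [Unitary.conjStarAlgAut_star_apply, Matrix.star_eq_conjTranspose] at h
  rw [h]
  simp

theorem Matrix.IsHermitian.re_trace_mul_self (hA : A.IsHermitian) :
    (A * A).trace.re = ∑ i, hA.eigenvalues i ^ 2 := by
  rw [hA.re_trace_mul_eq_sum_eigenvalues]
  simp only [hA.conj_eigenvectorUnitary_apply_self, sq]

theorem Matrix.IsHermitian.re_trace_eq_sum_eigenvalues (hA : A.IsHermitian) :
    A.trace.re = ∑ i, hA.eigenvalues i := by
  simp [hA.trace_eq_sum_eigenvalues]

/-- A state with unit trace cannot have a larger expectation than the largest eigenvalue. -/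
theorem Matrix.IsHermitian.exists_re_trace_mul_le_eigenvalue [Nonempty ι]
    (hA : A.IsHermitian) (hB : B.PosSemidef) (hBtr : B.trace = 1) :
    ∃ i, (B * A).trace.re ≤ hA.eigenvalues i := by
  obtain ⟨i, hi⟩ := Finite.exists_max hA.eigenvalues
  refine ⟨i, ?_⟩
  have hN := hB.conjTranspose_mul_mul_same (hA.eigenvectorUnitary : Matrix ι ι ℂ)
  have htr : ((hA.eigenvectorUnitary : Matrix ι ι ℂ)ᴴ * B *
      (hA.eigenvectorUnitary : Matrix ι ι ℂ)).trace = 1 := by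
    rw [Matrix.trace_mul_comm, ← Matrix.mul_assoc, ← Matrix.star_eq_conjTranspose,
      Unitary.mul_star_self_of_mem hA.eigenvectorUnitary.2, Matrix.one_mul, hBtr]
  rw [hA.re_trace_mul_eq_sum_eigenvalues]
  calc _ ≤ ∑ j, (((hA.eigenvectorUnitary : Matrix ι ι ℂ)ᴴ * B *
      (hA.eigenvectorUnitary : Matrix ι ι ℂ)) j j).re * hA.eigenvalues i :=
        Finset.sum_le_sum fun j _ =>
          mul_le_mul_of_nonneg_left (hi j) (Complex.le_def.1 hN.diag_nonneg).1
    _ = hA.eigenvalues i := by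
        have h := congrArg Complex.re htr
        rw [Matrix.trace, Complex.re_sum] at h
        simp only [Matrix.diag_apply, Complex.one_re] at h
        rw [← Finset.sum_mul, h, one_mul]

theorem Matrix.IsHermitian.eigenvalues_le_one (hA : A.IsHermitian) (h : (1 - A).PosSemidef)
    (i : ι) : hA.eigenvalues i ≤ 1 := by
  have hN := h.conjTranspose_mul_mul_same (hA.eigenvectorUnitary : Matrix ι ι ℂ)
  have hi := (Complex.le_def.1 (hN.diag_nonneg (i := i))).1
  have hU : (hA.eigenvectorUnitary : Matrix ι ι ℂ)ᴴ *
      (hA.eigenvectorUnitary : Matrix ι ι ℂ) = 1 := by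
    rw [← Matrix.star_eq_conjTranspose, Unitary.coe_star_mul_self]
  rw [Matrix.mul_sub, Matrix.mul_one, Matrix.sub_mul, hU, Matrix.sub_apply, Complex.sub_re,
    hA.conj_eigenvectorUnitary_apply_self] at hi
  simp only [Matrix.one_apply_eq, Complex.one_re, Complex.zero_re] at hi
  linarith

theorem Matrix.PosSemidef.re_trace_mul_self_le (hA : A.PosSemidef) :
    (A * A).trace.re ≤ A.trace.re ^ 2 := by
  rw [hA.isHermitian.re_trace_mul_self, hA.isHermitian.re_trace_eq_sum_eigenvalues]
  exact Finset.sum_sq_le_sq_sum_of_nonneg fun i _ => hA.eigenvalues_nonneg i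

/-- A unit-trace positive semidefinite matrix overlaps an effect by at most the effect's trace. -/
theorem Matrix.PosSemidef.re_trace_mul_le_re_trace [Nonempty ι] (hA : A.PosSemidef)
    (hB : B.PosSemidef) (hBtr : B.trace = 1) : (B * A).trace.re ≤ A.trace.re := by
  obtain ⟨i, hi⟩ := hA.isHermitian.exists_re_trace_mul_le_eigenvalue hB hBtr
  rw [hA.isHermitian.re_trace_eq_sum_eigenvalues]
  exact hi.trans (Finset.single_le_sum (fun j _ => hA.eigenvalues_nonneg j) (Finset.mem_univ i))

/-- If an effect `A` has expectation at least `t` in some state, its squared Frobenius norm exceeds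
one by at most `(tr A - t) ^ 2`. -/
theorem Matrix.PosSemidef.re_trace_mul_self_le_one_add [Nonempty ι] (hA : A.PosSemidef)
    (hA1 : (1 - A).PosSemidef) (hB : B.PosSemidef) (hBtr : B.trace = 1) {t : ℝ}
    (ht : t ≤ (B * A).trace.re) :
    (A * A).trace.re ≤ 1 + (A.trace.re - t) ^ 2 := by
  have hH := hA.isHermitian
  obtain ⟨i, hi⟩ := hH.exists_re_trace_mul_le_eigenvalue hB hBtr
  have h0 : ∀ j, 0 ≤ hH.eigenvalues j := hA.eigenvalues_nonneg
  have h1 := hH.eigenvalues_le_one hA1 i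
  rw [hH.re_trace_mul_self, hH.re_trace_eq_sum_eigenvalues,
    ← Finset.add_sum_erase _ _ (Finset.mem_univ i),
    ← Finset.add_sum_erase _ hH.eigenvalues (Finset.mem_univ i)]
  have hsq := Finset.sum_sq_le_sq_sum_of_nonneg (s := Finset.univ.erase i)
    (f := hH.eigenvalues) fun j _ => h0 j
  have hs : 0 ≤ ∑ j ∈ Finset.univ.erase i, hH.eigenvalues j := Finset.sum_nonneg fun j _ => h0 j
  have hle := pow_le_pow_left₀ hs (show _ ≤ hH.eigenvalues i +
    ∑ j ∈ Finset.univ.erase i, hH.eigenvalues j - t by linarith) 2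
  nlinarith [h0 i]

/-- Cauchy–Schwarz for the Frobenius inner product of Hermitian matrices, the first of which has
Frobenius norm at most one. -/
theorem Matrix.IsHermitian.sq_re_trace_mul_le (hA : A.IsHermitian) (hB : B.IsHermitian)
    (hA1 : (A * A).trace.re ≤ 1) : (A * B).trace.re ^ 2 ≤ (B * B).trace.re := by
  set c := (A * B).trace.re with hc
  have hH : (B - c • A).IsHermitian := hB.sub (by
    rw [Matrix.IsHermitian, Matrix.conjTranspose_smul, hA, star_trivial])
  have h : 0 ≤ ((B - c • A) * (B - c • A)).trace.re := by
    rw [hH.re_trace_mul_self]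
    positivity
  have hcomm : (B * A).trace.re = c := by rw [Matrix.trace_mul_comm]
  simp only [Matrix.sub_mul, Matrix.mul_sub, Matrix.smul_mul, Matrix.mul_smul, Matrix.trace_sub,
    Matrix.trace_smul, Complex.sub_re, Complex.smul_re, smul_eq_mul, hcomm, ← hc] at h
  nlinarith [mul_nonneg (sq_nonneg c) (sub_nonneg.2 hA1)]

end SpectralBounds

/-- Theorem 1, first bound of Eq. (3): robust certification of state overlaps. -/
theorem robust_certification_state_overlaps (d n : ℕ) (hd : 1 ≤ d)
    (ε : ℝ) (hε : 0 ≤ ε)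
    (ρ ρt Mt : Fin n → Fin d → Matrix (Fin d) (Fin d) ℂ)
    (hρ : ∀ x a, IsPureState (ρ x a))
    (hρsum : ∀ x, ∑ a, ρ x a = 1)
    (hρt : ∀ x a, IsDensityMatrix (ρt x a))
    (hMt : ∀ y b, (Mt y b).PosSemidef)
    (hMtsum : ∀ y, ∑ b, Mt y b = 1)
    (hstat : ∀ x y a b,
      |((ρt x a * Mt y b).trace).re - ((ρ x a * ρ y b).trace).re| ≤ ε) :
    ∀ x x' a a', x ≠ x' → a ≠ a' →
      |((ρt x a * ρt x' a').trace).re - ((ρ x a * ρ x' a').trace).re|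
        ≤ ε + Real.sqrt (2 * ε + (d : ℝ)^2 * ε^2) := by
  intro x x' a a' _ _
  have : Nonempty (Fin d) := ⟨⟨0, hd⟩⟩
  have hdiag : ∀ b, 1 - ε ≤ (ρt x' b * Mt x' b).trace.re := fun b => by
    have h := hstat x' x' b b
    rw [(hρ x' b).2.1, (hρ x' b).2.2, Complex.one_re] at h
    linarith [(abs_le.1 h).1]
  have htr : ∀ b, 1 - ε ≤ (Mt x' b).trace.re := fun b =>
    (hdiag b).trans ((hMt x' b).re_trace_mul_le_re_trace (hρt x' b).1 (hρt x' b).2)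
  have hM1 : (1 - Mt x' a').PosSemidef := by
    rw [← hMtsum x', ← Finset.add_sum_erase _ _ (Finset.mem_univ a'), add_sub_cancel_left]
    exact posSemidef_sum _ fun b _ => hMt x' b
  have hd_eq : ∑ b, ((Mt x' b).trace.re - (1 - ε)) = d * ε := by
    have h := congrArg (fun A => (Matrix.trace A).re) (hMtsum x')
    simp only [Matrix.trace_sum, Complex.re_sum, Matrix.trace_one, Fintype.card_fin,
      Complex.natCast_re] at h
    rw [Finset.sum_sub_distrib, h, Finset.sum_const, Finset.card_univ, Fintype.card_fin,
      nsmul_eq_mul]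
    ring
  have hexc : (Mt x' a').trace.re - (1 - ε) ≤ d * ε := hd_eq ▸
    Finset.single_le_sum (f := fun b => (Mt x' b).trace.re - (1 - ε))
      (fun b _ => sub_nonneg.2 (htr b)) (Finset.mem_univ a')
  have hMM := (hMt x' a').re_trace_mul_self_le_one_add hM1 (hρt x' a').1 (hρt x' a').2 (hdiag a')
  have hexc2 := pow_le_pow_left₀ (sub_nonneg.2 (htr a')) hexc 2
  have hpur : ∀ y b, (ρt y b * ρt y b).trace.re ≤ 1 := fun y b => by
    simpa [(hρt y b).2] using (hρt y b).1.re_trace_mul_self_le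
  have hdist : ((ρt x' a' - Mt x' a') * (ρt x' a' - Mt x' a')).trace.re
      ≤ 2 * ε + (d : ℝ) ^ 2 * ε ^ 2 := by
    have hcomm : (Mt x' a' * ρt x' a').trace.re = (ρt x' a' * Mt x' a').trace.re := by
      rw [Matrix.trace_mul_comm]
    simp only [Matrix.sub_mul, Matrix.mul_sub, Matrix.trace_sub, Complex.sub_re, hcomm]
    rw [← mul_pow]
    linarith [hpur x' a', hdiag a']
  have hCS := Real.abs_le_sqrt (((hρt x a).1.isHermitian.sq_re_trace_mul_le
    ((hρt x' a').1.isHermitian.sub (hMt x' a').isHermitian) (hpur x a)).trans hdist)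
  rw [Matrix.mul_sub, Matrix.trace_sub, Complex.sub_re] at hCS
  calc _ ≤ _ := abs_sub_le _ ((ρt x a * Mt x' a').trace.re) _
    _ ≤ _ := by linarith [hstat x x' a a']
end

section
/- In the prepare-and-measure scenario on ℂ^d with n settings: suppose the target pure states ρ^x_a (a∈[d], x∈[n]) are such that for each x the family (ρ^x_a)_a consists of rank-one orthogonal projections with ∑_a ρ^x_a = I, and suppose the experimental density matrices ρ̃^x_a and experimental d-outcome POVMs (M̃^y_b)_b on ℂ^d satisfy |Re tr(ρ̃^x_a M̃^y_b) − Re tr(ρ^x_a ρ^y_b)| ≤ ε for all a,b∈[d] and x,y∈[n]. Then for all y ≠ y' and b ≠ b', |Re tr(M̃^y_b M̃^{y'}_{b'}) − Re tr(ρ^y_b ρ^{y'}_{b'})| ≤ ε + (1 + dε)·√(2ε + d²ε²). (Theorem 1, second bound of Eq. (3): robust certification of measurement overlaps.) -/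
open Matrix
open scoped ComplexOrder

section Auxiliary

variable {n : Type*} [Fintype n] {A B M R : Matrix n n ℂ}

namespace Matrix

open scoped MatrixOrder Matrix.Norms.L2Operator in
lemma PosSemidef.re_trace_mul_nonneg (hA : A.PosSemidef) (hB : B.PosSemidef) :
    0 ≤ (A * B).trace.re := by
  classical
  obtain ⟨C, rfl⟩ := CStarAlgebra.nonneg_iff_eq_star_mul_self.mp hA.nonneg
  rw [Matrix.mul_assoc, trace_mul_comm]
  exact (Complex.le_def.mp (hB.mul_mul_conjTranspose_same C).trace_nonneg).1

lemma IsHermitian.re_trace_mul_self_nonneg (hA : A.IsHermitian) : 0 ≤ (A * A).trace.re := by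
  have h := (posSemidef_conjTranspose_mul_self A).trace_nonneg
  rw [hA.eq] at h
  exact (Complex.le_def.mp h).1

/-- The Cauchy–Schwarz inequality for the Hilbert–Schmidt inner product of Hermitian matrices. -/
lemma IsHermitian.sq_re_trace_mul_le_s3 (hA : A.IsHermitian) (hB : B.IsHermitian) :
    (A * B).trace.re ^ 2 ≤ (A * A).trace.re * (B * B).trace.re := by
  have key (t : ℝ) : 0 ≤ (B * B).trace.re * (t * t) + (2 * (A * B).trace.re) * t
      + (A * A).trace.re := by
    have ht : (A + (t : ℂ) • B).IsHermitian := by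
      refine hA.add ?_
      rw [IsHermitian, conjTranspose_smul, hB.eq]
      simp
    have h := ht.re_trace_mul_self_nonneg
    simp only [Matrix.add_mul, Matrix.mul_add, Matrix.smul_mul, Matrix.mul_smul, trace_add,
      trace_smul, trace_mul_comm B A, smul_eq_mul, Complex.add_re, Complex.re_ofReal_mul] at h
    linarith
  have := discrim_le_zero key
  rw [discrim] at this
  linarith

variable [DecidableEq n]

lemma IsHermitian.re_trace_eq_sum_eigenvalues_s3 (hA : A.IsHermitian) :
    A.trace.re = ∑ i, hA.eigenvalues i := by
  rw [hA.trace_eq_sum_eigenvalues]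
  simp

lemma IsHermitian.re_trace_mul_self_eq_sum_eigenvalues_sq (hA : A.IsHermitian) :
    (A * A).trace.re = ∑ i, hA.eigenvalues i ^ 2 := by
  conv_lhs => rw [hA.spectral_theorem, ← map_mul, Unitary.conjStarAlgAut_apply, trace_mul_cycle,
    Unitary.coe_star_mul_self, one_mul, diagonal_mul_diagonal,
    trace_diagonal]
  simp [pow_two]

lemma IsHermitian.smul_one_sub_eq (hA : A.IsHermitian) (c : ℝ) :
    (c : ℂ) • (1 : Matrix n n ℂ) - A =
      Unitary.conjStarAlgAut ℂ _ hA.eigenvectorUnitary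
        (diagonal fun i => ((c - hA.eigenvalues i : ℝ) : ℂ)) := by
  have hd : (diagonal fun i => ((c - hA.eigenvalues i : ℝ) : ℂ)) =
      (c : ℂ) • (1 : Matrix n n ℂ) - diagonal (RCLike.ofReal ∘ hA.eigenvalues) := by
    rw [smul_one_eq_diagonal, diagonal_sub]
    simp
  rw [hd, map_sub, map_smul, map_one, ← hA.spectral_theorem]

lemma IsHermitian.posSemidef_smul_one_sub_iff (hA : A.IsHermitian) (c : ℝ) :
    ((c : ℂ) • (1 : Matrix n n ℂ) - A).PosSemidef ↔ ∀ i, hA.eigenvalues i ≤ c := by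
  rw [hA.smul_one_sub_eq c, Unitary.conjStarAlgAut_apply,
    (Unitary.isUnit_coe).posSemidef_star_right_conjugate_iff, posSemidef_diagonal_iff]
  simp only [Complex.zero_le_real, sub_nonneg]

lemma PosSemidef.re_trace_mul_self_le_sq (hA : A.PosSemidef) :
    (A * A).trace.re ≤ A.trace.re ^ 2 := by
  rw [hA.1.re_trace_mul_self_eq_sum_eigenvalues_sq, hA.1.re_trace_eq_sum_eigenvalues_s3]
  exact Finset.sum_sq_le_sq_sum_of_nonneg fun i _ => hA.eigenvalues_nonneg i

/-- Some eigenvalue of `M` is at least the expectation of `M` in any state `R`. -/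
lemma IsHermitian.exists_re_trace_mul_le_eigenvalues (hM : M.IsHermitian) (hR : R.PosSemidef)
    (htr : R.trace = 1) : ∃ i, (R * M).trace.re ≤ hM.eigenvalues i := by
  have : Nonempty n := by
    by_contra h
    rw [not_nonempty_iff] at h
    simp [trace] at htr
  obtain ⟨i, hi⟩ := Finite.exists_max hM.eigenvalues
  have h := hR.re_trace_mul_nonneg ((hM.posSemidef_smul_one_sub_iff (hM.eigenvalues i)).2 hi)
  rw [Matrix.mul_sub, Matrix.mul_smul, Matrix.mul_one, trace_sub, trace_smul, htr] at h
  simp only [smul_eq_mul, mul_one, Complex.sub_re, Complex.ofReal_re, sub_nonneg] at h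
  exact ⟨i, h⟩

/-- An effect whose expectation in some state is at least `t` has trace at least `t`, and its
purity exceeds one by at most the square of the trace in excess of `t`. -/
lemma PosSemidef.le_re_trace_and_re_trace_mul_self_le (hM : M.PosSemidef)
    (hM1 : (1 - M).PosSemidef) (hR : R.PosSemidef) (htr : R.trace = 1) {t : ℝ}
    (ht : t ≤ (R * M).trace.re) :
    t ≤ M.trace.re ∧ (M * M).trace.re ≤ 1 + (M.trace.re - t) ^ 2 := by
  obtain ⟨i, hi⟩ := hM.1.exists_re_trace_mul_le_eigenvalues hR htr
  have hi1 : hM.1.eigenvalues i ≤ 1 :=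
    (hM.1.posSemidef_smul_one_sub_iff 1).1 (by simpa using hM1) i
  have hi0 := hM.eigenvalues_nonneg i
  rw [hM.1.re_trace_mul_self_eq_sum_eigenvalues_sq, hM.1.re_trace_eq_sum_eigenvalues_s3,
    ← Finset.add_sum_erase _ _ (Finset.mem_univ i), ← Finset.add_sum_erase _ _ (Finset.mem_univ i)]
  have hs := Finset.sum_sq_le_sq_sum_of_nonneg (s := Finset.univ.erase i)
    fun j _ => hM.eigenvalues_nonneg j
  have hs0 : 0 ≤ ∑ j ∈ Finset.univ.erase i, hM.1.eigenvalues j :=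
    Finset.sum_nonneg fun j _ => hM.eigenvalues_nonneg j
  constructor
  · linarith
  · nlinarith

end Matrix

/-- If every effect of a POVM `M` is recognised with probability at least `1 - ε` by a
corresponding state, then its effects are almost pure. -/
lemma re_trace_mul_self_le_of_povm [DecidableEq n] {M R : n → Matrix n n ℂ} {ε : ℝ}
    (hM : ∀ b, (M b).PosSemidef) (hsum : ∑ b, M b = 1) (hR : ∀ b, (R b).PosSemidef)
    (htr : ∀ b, (R b).trace = 1) (h : ∀ b, 1 - ε ≤ (R b * M b).trace.re) (b : n) :
    (M b * M b).trace.re ≤ 1 + (Fintype.card n : ℝ) ^ 2 * ε ^ 2 := by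
  have hM1 (c : n) : (1 - M c).PosSemidef := by
    rw [← hsum, ← Finset.add_sum_erase _ _ (Finset.mem_univ c), add_sub_cancel_left]
    exact posSemidef_sum _ fun j _ => hM j
  have key (c : n) :=
    (hM c).le_re_trace_and_re_trace_mul_self_le (hM1 c) (hR c) (htr c) (h c)
  have htrace : ∑ c, ((M c).trace.re - (1 - ε)) = Fintype.card n * ε := by
    rw [Finset.sum_sub_distrib, ← Complex.re_sum, ← trace_sum, hsum]
    simp
  have hb : (M b).trace.re - (1 - ε) ≤ Fintype.card n * ε := by
    rw [← htrace]
    exact Finset.single_le_sum (f := fun c => (M c).trace.re - (1 - ε))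
      (fun c _ => sub_nonneg.2 (key c).1) (Finset.mem_univ b)
  have hb0 : 0 ≤ (M b).trace.re - (1 - ε) := sub_nonneg.2 (key b).1
  have := pow_le_pow_left₀ hb0 hb 2
  rw [mul_pow] at this
  linarith [(key b).2]

end Auxiliary

/-- Theorem 1, second bound of Eq. (3): robust certification of measurement overlaps. -/
theorem robust_certification_measurement_overlaps (d n : ℕ) (hd : 1 ≤ d)
    (ε : ℝ) (hε : 0 ≤ ε)
    (ρ ρt Mt : Fin n → Fin d → Matrix (Fin d) (Fin d) ℂ)
    (hρ : ∀ x a, IsPureState (ρ x a))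
    (hρsum : ∀ x, ∑ a, ρ x a = 1)
    (hρt : ∀ x a, IsDensityMatrix (ρt x a))
    (hMt : ∀ y b, (Mt y b).PosSemidef)
    (hMtsum : ∀ y, ∑ b, Mt y b = 1)
    (hstat : ∀ x y a b,
      |((ρt x a * Mt y b).trace).re - ((ρ x a * ρ y b).trace).re| ≤ ε) :
    ∀ y y' b b', y ≠ y' → b ≠ b' →
      |((Mt y b * Mt y' b').trace).re - ((ρ y b * ρ y' b').trace).re|
        ≤ ε + (1 + (d : ℝ) * ε) * Real.sqrt (2 * ε + (d : ℝ)^2 * ε^2) := by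
  intro y y' b b' _ _
  have hguess (y : Fin n) (b : Fin d) : 1 - ε ≤ (ρt y b * Mt y b).trace.re := by
    have h := (abs_le.1 (hstat y y b b)).1
    rw [(hρ y b).2.1, (hρ y b).2.2, Complex.one_re] at h
    linarith
  have hpure (y : Fin n) (b : Fin d) :
      (Mt y b * Mt y b).trace.re ≤ 1 + (d : ℝ) ^ 2 * ε ^ 2 := by
    simpa using re_trace_mul_self_le_of_povm (hMt y) (hMtsum y) (fun b => (hρt y b).1)
      (fun b => (hρt y b).2) (hguess y) b
  have hdist : ((Mt y b - ρt y b) * (Mt y b - ρt y b)).trace.re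
      ≤ 2 * ε + (d : ℝ) ^ 2 * ε ^ 2 := by
    have hst := (hρt y b).1.re_trace_mul_self_le_sq
    rw [(hρt y b).2] at hst
    simp only [Matrix.sub_mul, Matrix.mul_sub, trace_sub, Complex.sub_re,
      trace_mul_comm (Mt y b) (ρt y b)]
    norm_num at hst
    linarith [hpure y b, hguess y b]
  have hdε : 0 ≤ (d : ℝ) * ε := by positivity
  have hcs : |((Mt y b - ρt y b) * Mt y' b').trace.re|
      ≤ (1 + (d : ℝ) * ε) * Real.sqrt (2 * ε + (d : ℝ) ^ 2 * ε ^ 2) := by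
    have hX := (hMt y b).1.sub (hρt y b).1.1
    apply abs_le_of_sq_le_sq _ (by positivity)
    calc _ ≤ _ := hX.sq_re_trace_mul_le_s3 (hMt y' b').1
      _ ≤ (2 * ε + (d : ℝ) ^ 2 * ε ^ 2) * (1 + (d : ℝ) * ε) ^ 2 := by
        refine mul_le_mul hdist ((hpure y' b').trans ?_)
          (hMt y' b').1.re_trace_mul_self_nonneg (by positivity)
        nlinarith
      _ = _ := by
        rw [mul_pow, Real.sq_sqrt (by positivity), mul_comm]
  rw [Matrix.sub_mul, trace_sub, Complex.sub_re] at hcs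
  have h := (abs_sub_le _ _ _).trans (add_le_add hcs (hstat y y' b b'))
  linarith
end

section
/- Let d ≥ 1, let (ρ_a)_{a∈[d]} be density matrices on ℂ^d and (M_a)_{a∈[d]} a d-outcome POVM on ℂ^d such that Re tr(ρ_a M_a) = 1 for every a ∈ [d]. Then M_a = ρ_a for every a, each ρ_a is a rank-one orthogonal projection, and ρ_a ρ_{a'} = 0 for a ≠ a'. (Ideal-case perfect-correlation argument underlying the certification scheme: perfect correlations force the experimental states to coincide with the corresponding projective measurement effects.) -/
open Matrix
open scoped ComplexOrder

namespace Matrix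

open scoped MatrixOrder

variable {n : Type*} [Fintype n]

lemma PosSemidef.exists_eq_conjTranspose_mul_self {A : Matrix n n ℂ} (hA : A.PosSemidef) :
    ∃ C : Matrix n n ℂ, A = Cᴴ * C := by
  classical
  exact CStarAlgebra.nonneg_iff_eq_star_mul_self.mp hA.nonneg

lemma PosSemidef.trace_mul_nonneg {A B : Matrix n n ℂ} (hA : A.PosSemidef)
    (hB : B.PosSemidef) : 0 ≤ (A * B).trace := by
  obtain ⟨C, rfl⟩ := hA.exists_eq_conjTranspose_mul_self
  rw [Matrix.mul_assoc, trace_mul_comm]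
  exact (hB.mul_mul_conjTranspose_same C).trace_nonneg

lemma PosSemidef.mul_eq_zero_of_trace_mul_eq_zero {A B : Matrix n n ℂ} (hA : A.PosSemidef)
    (hB : B.PosSemidef) (h : (A * B).trace = 0) : A * B = 0 := by
  obtain ⟨C, rfl⟩ := hA.exists_eq_conjTranspose_mul_self
  obtain ⟨D, rfl⟩ := hB.exists_eq_conjTranspose_mul_self
  have hCD : C * Dᴴ = 0 := by
    rw [← trace_conjTranspose_mul_self_eq_zero_iff, conjTranspose_mul,
      conjTranspose_conjTranspose, Matrix.mul_assoc, trace_mul_comm]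
    simpa only [Matrix.mul_assoc] using h
  rw [Matrix.mul_assoc, ← Matrix.mul_assoc C, hCD, Matrix.zero_mul, Matrix.mul_zero]

lemma PosSemidef.one_sub_of_trace_le_one [DecidableEq n] {A : Matrix n n ℂ}
    (hA : A.PosSemidef) (h : A.trace ≤ 1) : (1 - A).PosSemidef := by
  have hle (i : n) : hA.1.eigenvalues i ≤ 1 := by
    rw [hA.1.trace_eq_sum_eigenvalues] at h
    have hsum : ∑ j, hA.1.eigenvalues j ≤ 1 := by simpa using (Complex.le_def.mp h).1
    exact (Finset.single_le_sum (fun j _ ↦ hA.eigenvalues_nonneg j) (Finset.mem_univ i)).trans hsum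
  have hdiag : (1 : Matrix n n ℂ) - diagonal (RCLike.ofReal ∘ hA.1.eigenvalues) =
      diagonal fun i ↦ ((1 - hA.1.eigenvalues i : ℝ) : ℂ) := by
    rw [← diagonal_one, diagonal_sub]
    simp
  rw [hA.1.spectral_theorem, ← map_one (Unitary.conjStarAlgAut ℂ _ hA.1.eigenvectorUnitary),
    ← map_sub, hdiag, Unitary.conjStarAlgAut_apply]
  refine (PosSemidef.diagonal fun i ↦ ?_).mul_mul_conjTranspose_same _
  exact Complex.zero_le_real.mpr (sub_nonneg.mpr (hle i))

lemma trace_eq_rank_of_isIdempotentElem {K : Type*} [Field K] [DecidableEq n]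
    {A : Matrix n n K} (hA : IsIdempotentElem A) : A.trace = A.rank := by
  have h : IsIdempotentElem (toLin' A) := by
    rw [IsIdempotentElem, Module.End.mul_eq_comp, ← toLin'_mul, hA.eq]
  rw [← trace_toLin'_eq, (LinearMap.IsIdempotentElem.isProj_range _ h).trace, rank,
    toLin'_apply']

end Matrix

/-- Ideal-case perfect-correlation argument: perfect correlations force the
experimental states to coincide with the corresponding projective measurement
effects, which are rank-one orthogonal projections onto orthogonal subspaces. -/
theorem perfect_correlations_force_projective (d : ℕ) (hd : 1 ≤ d)
    (ρ M : Fin d → Matrix (Fin d) (Fin d) ℂ)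
    (hρ : ∀ a, IsDensityMatrix (ρ a))
    (hMpos : ∀ a, (M a).PosSemidef)
    (hMsum : ∑ a, M a = 1)
    (hcorr : ∀ a, ((ρ a * M a).trace).re = 1) :
    (∀ a, M a = ρ a) ∧
    (∀ a, IsPureState (ρ a) ∧ (ρ a).rank = 1) ∧
    (∀ a a', a ≠ a' → ρ a * ρ a' = 0) := by
  have hMone (a : Fin d) : (ρ a * M a).trace = 1 := by
    have h := Complex.nonneg_iff.mp ((hρ a).1.trace_mul_nonneg (hMpos a))
    exact Complex.ext (hcorr a) h.2.symm
  have hoff (a b : Fin d) (hab : b ≠ a) : ρ a * M b = 0 := by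
    have hsum : ∑ c, (ρ a * M c).trace = 1 := by
      rw [← trace_sum, ← Finset.mul_sum, hMsum, mul_one, (hρ a).2]
    rw [← Finset.add_sum_erase _ _ (Finset.mem_univ a), hMone, add_eq_left,
      Finset.sum_eq_zero_iff_of_nonneg
        fun c _ ↦ (hρ a).1.trace_mul_nonneg (hMpos c)] at hsum
    exact (hρ a).1.mul_eq_zero_of_trace_mul_eq_zero (hMpos b) (hsum b (by simp [hab]))
  have hdiag (a : Fin d) : ρ a * M a = ρ a := by
    have h := Finset.sum_eq_single (s := Finset.univ) (f := fun b ↦ ρ a * M b) a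
      (fun b _ hb ↦ hoff a b hb) (by simp)
    rwa [← Finset.mul_sum, hMsum, mul_one, eq_comm] at h
  have hcompl (a : Fin d) : (1 - ρ a).PosSemidef :=
    (hρ a).1.one_sub_of_trace_le_one (hρ a).2.le
  have htrace : ∑ a, ((1 - ρ a) * M a).trace = 0 := by
    simp only [sub_mul, one_mul, trace_sub, hMone, Finset.sum_sub_distrib]
    rw [← trace_sum, hMsum]
    simp
  rw [Finset.sum_eq_zero_iff_of_nonneg
    fun a _ ↦ (hcompl a).trace_mul_nonneg (hMpos a)] at htrace
  have hMρ (a : Fin d) : M a = ρ a := by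
    have h := (hcompl a).mul_eq_zero_of_trace_mul_eq_zero (hMpos a) (htrace a (Finset.mem_univ a))
    rwa [sub_mul, one_mul, hdiag, sub_eq_zero] at h
  have hidem (a : Fin d) : ρ a * ρ a = ρ a := by
    have h := hdiag a
    rwa [hMρ] at h
  refine ⟨hMρ, fun a ↦ ⟨⟨(hρ a).1.1, hidem a, (hρ a).2⟩, ?_⟩, fun a b hab ↦ ?_⟩
  · have h := trace_eq_rank_of_isIdempotentElem (hidem a)
    rw [(hρ a).2] at h
    exact_mod_cast h.symm
  · rw [← hMρ b]
    exact hoff a b hab.symm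
end

section
/- Let 0 ≤ ε ≤ 1/3. Let ρ_1, ρ_2 be density matrices on ℂ² and let (M_1, M_2) be a 2-outcome POVM on ℂ² such that Re tr(ρ_a M_a) ≥ 1 − ε for a = 1,2. Then ‖ρ_a‖ ≥ (1 − 2ε)/(1 − ε) for a = 1,2, where ‖·‖ is the operator norm. (Lemma 1, first claim: improved qubit bound on the purity of the experimental states.) -/
open Matrix
open scoped ComplexOrder

/-- The trace of a square complex matrix is the sum of its diagonal matrix elements in any
orthonormal basis. -/
lemma trace_eq_sum_inner_toEuclideanLin {d : ℕ} (A : Matrix (Fin d) (Fin d) ℂ)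
    (b : OrthonormalBasis (Fin d) ℂ (EuclideanSpace ℂ (Fin d))) :
    A.trace = ∑ i, inner ℂ (b i) (toEuclideanLin A (b i)) := by
  rw [← LinearMap.trace_eq_sum_inner (toEuclideanLin A) b, toEuclideanLin_eq_toLin_orthonormal,
    Matrix.trace_toLin_eq]

/-- The trace of `A * M` for Hermitian `M`, expanded in an eigenbasis of `M`. -/
lemma re_trace_mul_eq_sum_eigenvalues {d : ℕ} (A : Matrix (Fin d) (Fin d) ℂ)
    {M : Matrix (Fin d) (Fin d) ℂ} (hM : M.IsHermitian) :
    (A * M).trace.re = ∑ i, hM.eigenvalues i *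
      (inner ℂ (hM.eigenvectorBasis i) (toEuclideanLin A (hM.eigenvectorBasis i))).re := by
  rw [trace_eq_sum_inner_toEuclideanLin _ hM.eigenvectorBasis, Complex.re_sum]
  refine Finset.sum_congr rfl fun i _ => ?_
  have h : toEuclideanLin (A * M) (hM.eigenvectorBasis i) =
      (hM.eigenvalues i : ℂ) • toEuclideanLin A (hM.eigenvectorBasis i) := by
    rw [toLpLin_apply, ← mulVec_mulVec, hM.mulVec_eigenvectorBasis, mulVec_smul]
    rfl
  rw [h, inner_smul_right, Complex.re_ofReal_mul]

lemma Matrix.PosSemidef.re_inner_toEuclideanLin_nonneg {d : ℕ} {A : Matrix (Fin d) (Fin d) ℂ}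
    (hA : A.PosSemidef) (v : EuclideanSpace ℂ (Fin d)) :
    0 ≤ (inner ℂ v (toEuclideanLin A v)).re :=
  (isPositive_toEuclideanLin_iff.mpr hA).re_inner_nonneg_right v

lemma re_inner_toEuclideanLin_le_opNorm {d : ℕ} (A : Matrix (Fin d) (Fin d) ℂ)
    {v : EuclideanSpace ℂ (Fin d)} (hv : ‖v‖ = 1) :
    (inner ℂ v (toEuclideanLin A v)).re ≤ opNorm A := by
  have h := (LinearMap.toContinuousLinearMap (toEuclideanLin A)).le_opNorm v
  have h' := re_inner_le_norm (𝕜 := ℂ) v (toEuclideanLin A v)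
  rw [hv, mul_one] at h
  rw [hv, one_mul] at h'
  exact h'.trans h

/-- The eigenvalues of a Hermitian matrix bounded above by the identity are at most one. -/
lemma Matrix.IsHermitian.eigenvalues_le_one_s7 {d : ℕ} {M : Matrix (Fin d) (Fin d) ℂ}
    (hM : M.IsHermitian) (h : (1 - M).PosSemidef) (i : Fin d) : hM.eigenvalues i ≤ 1 := by
  have h0 := h.re_inner_toEuclideanLin_nonneg (hM.eigenvectorBasis i)
  have h1 : toEuclideanLin (1 - M) (hM.eigenvectorBasis i) =
      ((1 - hM.eigenvalues i : ℝ) : ℂ) • hM.eigenvectorBasis i := by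
    rw [toLpLin_apply, sub_mulVec, one_mulVec, hM.mulVec_eigenvectorBasis]
    ext j
    simp [sub_mul]
  rw [h1, inner_smul_right, inner_self_eq_norm_sq_to_K, hM.eigenvectorBasis.norm_eq_one] at h0
  simpa using h0

/-- If an effect `M` accepts the qubit state `ρ` with probability at least `1 - ε` and the state
`σ` with probability at most `ε`, then `ρ` has operator norm at least `(1 - 2ε) / (1 - ε)`. -/
lemma le_opNorm_of_discriminated {ε : ℝ} (hε : ε < 1) {ρ σ M : Matrix (Fin 2) (Fin 2) ℂ}
    (hρ : IsDensityMatrix ρ) (hσ : IsDensityMatrix σ) (hM : M.IsHermitian)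
    (hM1 : (1 - M).PosSemidef) (hρM : 1 - ε ≤ (ρ * M).trace.re) (hσM : (σ * M).trace.re ≤ ε) :
    (1 - 2 * ε) / (1 - ε) ≤ opNorm ρ := by
  have norm_ge := fun i => re_inner_toEuclideanLin_le_opNorm ρ (hM.eigenvectorBasis.norm_eq_one i)
  have ρ_nonneg := fun i => hρ.1.re_inner_toEuclideanLin_nonneg (hM.eigenvectorBasis i)
  have σ_nonneg := fun i => hσ.1.re_inner_toEuclideanLin_nonneg (hM.eigenvectorBasis i)
  have ρ_sum := congrArg Complex.re
    ((trace_eq_sum_inner_toEuclideanLin ρ hM.eigenvectorBasis).symm.trans hρ.2)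
  have σ_sum := congrArg Complex.re
    ((trace_eq_sum_inner_toEuclideanLin σ hM.eigenvectorBasis).symm.trans hσ.2)
  have eig_le := hM.eigenvalues_le_one_s7 hM1
  rw [re_trace_mul_eq_sum_eigenvalues _ hM] at hρM hσM
  rw [Fin.sum_univ_two] at hρM hσM
  rw [Complex.re_sum, Fin.sum_univ_two, Complex.one_re] at ρ_sum σ_sum
  generalize hM.eigenvalues = p at *
  generalize hs : (fun i => (inner ℂ (hM.eigenvectorBasis i)
    (toEuclideanLin ρ (hM.eigenvectorBasis i))).re) = s
  generalize ht : (fun i => (inner ℂ (hM.eigenvectorBasis i)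
    (toEuclideanLin σ (hM.eigenvectorBasis i))).re) = t
  simp only [fun i => congrFun hs i, fun i => congrFun ht i] at *
  have small : p 0 ≤ ε ∨ p 1 ≤ ε := by
    by_contra! h
    rcases (σ_nonneg 0).eq_or_lt with h0 | h0
    · rw [← h0] at hσM σ_sum
      nlinarith
    · nlinarith [mul_pos h0 (sub_pos.mpr h.1), mul_nonneg (σ_nonneg 1) (sub_pos.mpr h.2).le]
  rw [div_le_iff₀ (by linarith)]
  rcases small with h | h
  · nlinarith [mul_le_mul_of_nonneg_right h (ρ_nonneg 0),
      mul_le_mul_of_nonneg_right (eig_le 1) (ρ_nonneg 1),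
      mul_le_mul_of_nonneg_right (norm_ge 1) (sub_pos.mpr hε).le]
  · nlinarith [mul_le_mul_of_nonneg_right h (ρ_nonneg 1),
      mul_le_mul_of_nonneg_right (eig_le 0) (ρ_nonneg 0),
      mul_le_mul_of_nonneg_right (norm_ge 0) (sub_pos.mpr hε).le]

/-- Lemma 1, first claim: improved qubit bound on the purity of the
experimental states. -/
theorem qubit_purity_bound (ε : ℝ) (hε0 : 0 ≤ ε) (hε : ε ≤ 1/3)
    (ρ M : Fin 2 → Matrix (Fin 2) (Fin 2) ℂ)
    (hρ : ∀ a, IsDensityMatrix (ρ a))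
    (hMpos : ∀ a, (M a).PosSemidef)
    (hMsum : ∑ a, M a = 1)
    (hcorr : ∀ a, 1 - ε ≤ ((ρ a * M a).trace).re) :
    ∀ a, (1 - 2 * ε) / (1 - ε) ≤ opNorm (ρ a) := by
  have discriminate : ∀ a b, M a + M b = 1 →
      (1 - 2 * ε) / (1 - ε) ≤ opNorm (ρ a) := by
    intro a b hab
    have hb : M b = 1 - M a := eq_sub_of_add_eq' hab
    refine le_opNorm_of_discriminated (by linarith) (hρ a) (hρ b) (hMpos a).1
      (hb ▸ hMpos b) (hcorr a) ?_
    have h := hcorr b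
    rw [hb, mul_sub, mul_one, trace_sub, (hρ b).2, Complex.sub_re, Complex.one_re] at h
    linarith
  rw [Fin.sum_univ_two] at hMsum
  exact Fin.forall_fin_two.mpr
    ⟨discriminate 0 1 hMsum, discriminate 1 0 (by rwa [add_comm])⟩
end

section
/- In the prepare-and-measure scenario on ℂ² with n settings: suppose the target pure qubit states ρ^x_a (a∈{1,2}, x∈[n]) are such that for each x the pair (ρ^x_1, ρ^x_2) consists of rank-one orthogonal projections with ρ^x_1 + ρ^x_2 = I, and suppose the experimental density matrices ρ̃^x_a on ℂ² and experimental 2-outcome POVMs (M̃^y_1, M̃^y_2) on ℂ² satisfy |Re tr(ρ̃^x_a M̃^y_b) − Re tr(ρ^x_a ρ^y_b)| ≤ ε for all a,b∈{1,2}, x,y∈[n], with 0 ≤ ε ≤ 1/3. Then for all y ≠ y' and b ≠ b', |Re tr(M̃^y_b M̃^{y'}_{b'}) − Re tr(ρ^y_b ρ^{y'}_{b'})| ≤ ε + (1 + ε)√ε. (Lemma 1, third claim: improved qubit overlap bound for measurement effects.) -/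
open Matrix
open scoped ComplexOrder

/-- The scalar estimate behind the overlap bound: `d` and `e` are the trace defects of the two
effects and `S` is the distance between a Bloch vector and its experimental approximation. -/
lemma trace_defect_add_distance_le {s d e S : ℝ} (hs0 : 0 ≤ s) (hs1 : s ≤ 1)
    (he : 0 ≤ e) (hed : e ≤ d) (hd : d ≤ s ^ 2) (hS : S ^ 2 ≤ 4 * s ^ 2 - 2 * d + d ^ 2) :
    d + e + d * e + (1 - e) * S ≤ 2 * s + 2 * s ^ 3 := by
  rcases hs0.eq_or_lt with rfl | hs
  · have hd0 : d = 0 := by nlinarith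
    have he0 : e = 0 := by linarith
    subst hd0 he0
    have : S = 0 := by nlinarith [sq_nonneg S]
    simp [this]
  obtain ⟨k, rfl⟩ : ∃ k, d = s ^ 2 * k := ⟨d / s ^ 2, by field_simp⟩
  have hs2 : 0 < s ^ 2 := by positivity
  have hk0 : 0 ≤ k := by
    by_contra! h
    nlinarith
  have hk1 : k ≤ 1 := by
    by_contra! h
    nlinarith
  have hkk : k ^ 2 ≤ 1 := by nlinarith
  have hs2_le : s ^ 2 ≤ 1 := by nlinarith
  obtain ⟨B, hB⟩ : ∃ B, B = s * (2 - k / 2 + s ^ 2 * k ^ 2 / 4) := ⟨_, rfl⟩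
  have hSB : S ≤ B := by
    have h : 4 * s * S ≤ 4 * s * B := by
      rw [hB]
      nlinarith [sq_nonneg (S - 2 * s)]
    exact le_of_mul_le_mul_left h (by positivity)
  have hB_le : s ^ 2 * k + B ≤ 2 * s + 2 * s ^ 3 := by
    have h : s * k + (2 - k / 2 + s ^ 2 * k ^ 2 / 4) ≤ 2 + 2 * s ^ 2 := by
      nlinarith [mul_nonneg hk0 (sq_nonneg (1 - s)), mul_nonneg hs2.le (sub_nonneg.2 hkk),
        mul_nonneg hs2.le (sub_nonneg.2 hk1)]
    rw [hB]
    nlinarith [mul_le_mul_of_nonneg_left h hs.le]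
  have hB_le' : 2 * (s ^ 2 * k) + (s ^ 2 * k) ^ 2 + (1 - s ^ 2 * k) * B ≤ 2 * s + 2 * s ^ 3 := by
    have h3 : s ^ 3 * k ^ 2 ≤ s ^ 2 := by
      have : s * k ^ 2 ≤ 1 := mul_le_one₀ hs1 (sq_nonneg k) hkk
      nlinarith
    have h : 2 * s * k + s ^ 3 * k ^ 2 + (1 - s ^ 2 * k) * (2 - k / 2 + s ^ 2 * k ^ 2 / 4)
        ≤ 2 + 2 * s ^ 2 := by
      have h4 : 0 ≤ s ^ 4 * k ^ 3 := by positivity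
      nlinarith [mul_nonneg hk0 (sq_nonneg (1 - 2 * s)), mul_nonneg hs2.le (sub_nonneg.2 hkk)]
    rw [hB]
    nlinarith [mul_le_mul_of_nonneg_left h hs.le]
  have he1 : 0 ≤ 1 - e := by nlinarith
  have hSB' : (1 - e) * S ≤ (1 - e) * B := mul_le_mul_of_nonneg_left hSB he1
  refine le_trans (add_le_add_right hSB' _) ?_
  rcases le_total B (1 + s ^ 2 * k) with h | h
  · nlinarith [mul_nonneg (sub_nonneg.2 hed) (sub_nonneg.2 h)]
  · nlinarith [mul_nonneg he (sub_nonneg.2 h)]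

/-- The overlap bound in terms of Bloch vectors, when the second effect has the smaller
trace defect. -/
lemma abs_bloch_overlap_sub_le {E : Type*} [NormedAddCommGroup E] [InnerProductSpace ℝ E]
    {n n' v₀ v₁ : E} {Δ Δ' T ε : ℝ} (hε0 : 0 ≤ ε) (hε : ε ≤ 1)
    (hv₀ : ‖v₀‖ ≤ 1) (hv₁ : ‖v₁‖ ≤ 1) (hn : ‖n‖ ≤ 1 - |Δ|) (hn' : ‖n'‖ ≤ 1 - |Δ'|)
    (hΔ : |Δ'| ≤ |Δ|)
    (h₀ : 1 - ε ≤ (1 + Δ + inner ℝ v₀ n) / 2) (h₁ : (1 + Δ + inner ℝ v₁ n) / 2 ≤ ε)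
    (h₀' : |(1 + Δ' + inner ℝ v₀ n') / 2 - T| ≤ ε)
    (h₁' : |(1 + Δ' + inner ℝ v₁ n') / 2 - (1 - T)| ≤ ε) :
    |((1 + Δ) * (1 + Δ') + inner ℝ n n') / 2 - T| ≤ ε + (1 + ε) * √ε := by
  have hs : √ε ^ 2 = ε := Real.sq_sqrt hε0
  have hcs₀ : inner ℝ v₀ n ≤ 1 - |Δ| :=
    (real_inner_le_norm _ _).trans (by nlinarith [norm_nonneg n])
  have hcs₁ : -inner ℝ v₁ n ≤ 1 - |Δ| := by
    have := (abs_le.1 (abs_real_inner_le_norm v₁ n)).1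
    nlinarith [norm_nonneg n]
  have hΔε : |Δ| ≤ ε := by
    rcases abs_cases Δ with ⟨h, _⟩ | ⟨h, _⟩ <;> linarith
  obtain ⟨w, hw⟩ : ∃ w : E, w = (1 / 2 : ℝ) • (v₀ - v₁) := ⟨_, rfl⟩
  have hinner (x : E) : inner ℝ w x = (inner ℝ v₀ x - inner ℝ v₁ x) / 2 := by
    rw [hw, inner_smul_left, inner_sub_left]
    simp
    ring
  have hw1 : ‖w‖ ≤ 1 := by
    rw [hw, norm_smul]
    have := norm_sub_le v₀ v₁
    norm_num
    linarith
  have hdist : ‖n - w‖ ^ 2 ≤ 4 * √ε ^ 2 - 2 * |Δ| + |Δ| ^ 2 := by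
    rw [norm_sub_sq_real, real_inner_comm, hinner, hs]
    have hnn : ‖n‖ ^ 2 ≤ (1 - |Δ|) ^ 2 := pow_le_pow_left₀ (norm_nonneg n) hn 2
    have hww : ‖w‖ ^ 2 ≤ 1 := pow_le_one₀ (norm_nonneg w) hw1
    linarith
  have hscalar := trace_defect_add_distance_le (Real.sqrt_nonneg ε) (Real.sqrt_le_one.2 hε)
    (abs_nonneg Δ') hΔ (by rwa [hs]) hdist
  have hrest : |inner ℝ (n - w) n'| ≤ (1 - |Δ'|) * ‖n - w‖ :=
    (abs_real_inner_le_norm _ _).trans (by nlinarith [norm_nonneg (n - w)])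
  rw [inner_sub_left, hinner] at hrest
  have hprod : |Δ + Δ' + Δ * Δ'| ≤ |Δ| + |Δ'| + |Δ| * |Δ'| := by
    rw [← abs_mul]
    exact abs_add_three _ _ _
  have hcube : √ε ^ 3 = ε * √ε := by rw [pow_succ, hs]
  rw [hcube] at hscalar
  rw [abs_le] at h₀' h₁' hrest hprod ⊢
  constructor <;> nlinarith

/-- The Bloch vector of a 2 × 2 Hermitian matrix. -/
noncomputable def blochVector (A : Matrix (Fin 2) (Fin 2) ℂ) : EuclideanSpace ℝ (Fin 3) :=
  !₂[2 * (A 0 1).re, 2 * (A 0 1).im, (A 0 0).re - (A 1 1).re]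

lemma blochVector_one_sub (A : Matrix (Fin 2) (Fin 2) ℂ) :
    blochVector (1 - A) = -blochVector A := by
  ext i
  fin_cases i <;> simp [blochVector]

lemma Matrix.IsHermitian.fin_two_entries {A : Matrix (Fin 2) (Fin 2) ℂ} (hA : A.IsHermitian) :
    (A 0 0).im = 0 ∧ (A 1 1).im = 0 ∧ (A 1 0).re = (A 0 1).re ∧ (A 1 0).im = -(A 0 1).im := by
  refine ⟨Complex.conj_eq_iff_im.1 (hA.apply 0 0), Complex.conj_eq_iff_im.1 (hA.apply 1 1), ?_, ?_⟩
  · simpa using congrArg Complex.re (hA.apply 1 0).symm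
  · simpa using congrArg Complex.im (hA.apply 1 0).symm

lemma re_trace_mul_eq_blochVector {A B : Matrix (Fin 2) (Fin 2) ℂ}
    (hA : A.IsHermitian) (hB : B.IsHermitian) :
    (A * B).trace.re
      = (A.trace.re * B.trace.re + inner ℝ (blochVector A) (blochVector B)) / 2 := by
  obtain ⟨a₁, a₂, a₃, a₄⟩ := hA.fin_two_entries
  obtain ⟨b₁, b₂, b₃, b₄⟩ := hB.fin_two_entries
  simp [blochVector, Matrix.trace_fin_two, Matrix.mul_apply, Fin.sum_univ_succ,
    PiLp.inner_apply, a₁, a₂, a₃, a₄, b₁, b₂, b₃, b₄]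
  ring

lemma Matrix.PosSemidef.norm_blochVector_le {A : Matrix (Fin 2) (Fin 2) ℂ}
    (hA : A.PosSemidef) : ‖blochVector A‖ ≤ A.trace.re := by
  obtain ⟨a₁, a₂, a₃, a₄⟩ := hA.isHermitian.fin_two_entries
  have htr : 0 ≤ A.trace.re := (Complex.le_def.1 hA.trace_nonneg).1
  have hdet : 0 ≤ A.det.re := (Complex.le_def.1 hA.det_nonneg).1
  refine abs_le_of_sq_le_sq' ?_ htr |>.2
  rw [EuclideanSpace.norm_sq_eq]
  simp [Matrix.det_fin_two, Matrix.trace_fin_two, a₁, a₂, a₃, a₄] at hdet ⊢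
  simp [blochVector, Fin.sum_univ_succ]
  nlinarith

/-- An effect with trace `1 + Δ` has a Bloch vector of norm at most `1 - |Δ|`. -/
lemma norm_blochVector_le_of_effect {P : Matrix (Fin 2) (Fin 2) ℂ}
    (hP : P.PosSemidef) (hP' : (1 - P).PosSemidef) :
    ‖blochVector P‖ ≤ 1 - |P.trace.re - 1| := by
  have h₀ := hP.norm_blochVector_le
  have h₁ := hP'.norm_blochVector_le
  rw [blochVector_one_sub, norm_neg] at h₁
  simp [Matrix.trace_sub] at h₁
  rcases abs_cases (P.trace.re - 1) with ⟨h, _⟩ | ⟨h, _⟩ <;> linarith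

/-- The overlap bound for two effects `P`, `Q` when the trace of `Q` is closer to one,
`R₀` and `R₁` being the states that approximate the targets `p` and `1 - p`. -/
lemma abs_overlap_sub_le_of_trace_defect_le {P Q R₀ R₁ p q : Matrix (Fin 2) (Fin 2) ℂ} {ε : ℝ}
    (hε0 : 0 ≤ ε) (hε : ε ≤ 1) (hP : P.PosSemidef) (hP' : (1 - P).PosSemidef)
    (hQ : Q.PosSemidef) (hQ' : (1 - Q).PosSemidef)
    (hR₀ : IsDensityMatrix R₀) (hR₁ : IsDensityMatrix R₁)
    (hp : IsPureState p) (hq : IsPureState q)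
    (h₀ : |(R₀ * P).trace.re - (p * p).trace.re| ≤ ε)
    (h₁ : |(R₁ * P).trace.re - ((1 - p) * p).trace.re| ≤ ε)
    (h₀' : |(R₀ * Q).trace.re - (p * q).trace.re| ≤ ε)
    (h₁' : |(R₁ * Q).trace.re - ((1 - p) * q).trace.re| ≤ ε)
    (hPQ : |Q.trace.re - 1| ≤ |P.trace.re - 1|) :
    |(P * Q).trace.re - (p * q).trace.re| ≤ ε + (1 + ε) * √ε := by
  have hR₀n := hR₀.1.norm_blochVector_le
  have hR₁n := hR₁.1.norm_blochVector_le
  rw [sub_mul, one_mul, trace_sub, hp.2.1, sub_self, Complex.zero_re,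
    re_trace_mul_eq_blochVector hR₁.1.isHermitian hP.isHermitian, hR₁.2] at h₁
  rw [hp.2.1, hp.2.2, re_trace_mul_eq_blochVector hR₀.1.isHermitian hP.isHermitian, hR₀.2] at h₀
  rw [re_trace_mul_eq_blochVector hR₀.1.isHermitian hQ.isHermitian, hR₀.2] at h₀'
  rw [sub_mul, one_mul, trace_sub, hq.2.2, Complex.sub_re,
    re_trace_mul_eq_blochVector hR₁.1.isHermitian hQ.isHermitian, hR₁.2] at h₁'
  rw [hR₀.2] at hR₀n
  rw [hR₁.2] at hR₁n
  simp only [Complex.one_re, one_mul, sub_zero] at h₀ h₁ h₀' h₁' hR₀n hR₁n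
  have key := abs_bloch_overlap_sub_le (T := (p * q).trace.re) hε0 hε hR₀n hR₁n
    (norm_blochVector_le_of_effect hP hP') (norm_blochVector_le_of_effect hQ hQ') hPQ
    (by linarith [(abs_le.1 h₀).1]) (by linarith [(abs_le.1 h₁).2])
    (by simpa using h₀') (by simpa using h₁')
  rw [re_trace_mul_eq_blochVector hP.isHermitian hQ.isHermitian]
  simpa using key

/-- Lemma 1, third claim: improved qubit overlap bound for measurement effects. -/
theorem qubit_measurement_overlap_bound (n : ℕ) (ε : ℝ) (hε0 : 0 ≤ ε) (hε : ε ≤ 1/3)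
    (ρ ρt Mt : Fin n → Fin 2 → Matrix (Fin 2) (Fin 2) ℂ)
    (hρ : ∀ x a, IsPureState (ρ x a))
    (hρsum : ∀ x, ρ x 0 + ρ x 1 = 1)
    (hρt : ∀ x a, IsDensityMatrix (ρt x a))
    (hMt : ∀ y b, (Mt y b).PosSemidef)
    (hMtsum : ∀ y, Mt y 0 + Mt y 1 = 1)
    (hstat : ∀ x y a b,
      |((ρt x a * Mt y b).trace).re - ((ρ x a * ρ y b).trace).re| ≤ ε) :
    ∀ y y' b b', y ≠ y' → b ≠ b' →
      |((Mt y b * Mt y' b').trace).re - ((ρ y b * ρ y' b').trace).re|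
        ≤ ε + (1 + ε) * Real.sqrt ε := by
  have hadd {A : Fin 2 → Matrix (Fin 2) (Fin 2) ℂ} (h : A 0 + A 1 = 1) (b : Fin 2) :
      A (1 - b) = 1 - A b := by
    fin_cases b
    · exact eq_sub_of_add_eq' h
    · exact eq_sub_of_add_eq h
  have heffect (y b) : (1 - Mt y b).PosSemidef := hadd (hMtsum y) b ▸ hMt y (1 - b)
  have main (y y' b b') (h : |(Mt y' b').trace.re - 1| ≤ |(Mt y b).trace.re - 1|) :
      |((Mt y b * Mt y' b').trace).re - ((ρ y b * ρ y' b').trace).re|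
        ≤ ε + (1 + ε) * Real.sqrt ε :=
    abs_overlap_sub_le_of_trace_defect_le hε0 (by linarith) (hMt y b) (heffect y b)
      (hMt y' b') (heffect y' b') (hρt y b) (hρt y (1 - b)) (hρ y b) (hρ y' b')
      (hstat y y b b) (hadd (hρsum y) b ▸ hstat y y (1 - b) b)
      (hstat y y' b b') (hadd (hρsum y) b ▸ hstat y y' (1 - b) b') h
  intro y y' b b' _ _
  rcases le_total |(Mt y' b').trace.re - 1| |(Mt y b).trace.re - 1| with h | h
  · exact main y y' b b' h
  · rw [trace_mul_comm (Mt y b), trace_mul_comm (ρ y b)]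
    exact main y' y b' b h
end

section
/- For every ε with 0 < ε ≤ 1/2 there exist: target pure qubit states ρ^x_a (a,x ∈ {1,2}) with ρ^x_1 + ρ^x_2 = I for each x (namely ρ^1_1 = |θ⟩⟨θ| with |θ⟩ = √(1−ε)|0⟩ + √ε|1⟩ and ρ^2_1 = |+⟩⟨+|), experimental density matrices ρ̃^x_a on ℂ², and experimental 2-outcome POVMs (M̃^y_1, M̃^y_2) on ℂ², such that |Re tr(ρ̃^x_a M̃^y_b) − Re tr(ρ^x_a ρ^y_b)| ≤ ε for all a,b,x,y ∈ {1,2}, and yet |Re tr(ρ^1_1 ρ^2_1) − Re tr(ρ̃^1_1 ρ̃^2_1)| = √(ε − ε²). (Appendix A: the overlap-deviation bound of Theorem 1 is saturated to first order in √ε, witnessed by ρ̃^1_1 = |0⟩⟨0|, ρ̃^1_2 = |1⟩⟨1|, ρ̃^2_1 = |+⟩⟨+|, ρ̃^2_2 = |−⟩⟨−|, M̃^1_1 = |θ⟩⟨θ|, M̃^2_1 = |θ'⟩⟨θ'| with |θ'⟩ = √(1−ε)|+⟩ + √ε|−⟩.) -/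
open Matrix
open scoped ComplexOrder

/-- The qubit operator `(1 + c σ_z + s σ_x) / 2` with real Bloch vector `(c, s)`. -/
noncomputable def realBloch (c s : ℝ) : Matrix (Fin 2) (Fin 2) ℂ :=
  !![(((1 + c) / 2 : ℝ) : ℂ), ((s / 2 : ℝ) : ℂ); ((s / 2 : ℝ) : ℂ), (((1 - c) / 2 : ℝ) : ℂ)]

theorem realBloch_trace (c s : ℝ) : (realBloch c s).trace = 1 := by
  simp only [realBloch, Matrix.trace_fin_two_of]
  push_cast
  ring

theorem realBloch_isHermitian (c s : ℝ) : (realBloch c s).IsHermitian := by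
  ext i j
  fin_cases i <;> fin_cases j <;> simp [realBloch]

theorem realBloch_mul_self {c s : ℝ} (h : c ^ 2 + s ^ 2 = 1) :
    realBloch c s * realBloch c s = realBloch c s := by
  have h' : (c : ℂ) ^ 2 + (s : ℂ) ^ 2 = 1 := mod_cast h
  ext i j
  fin_cases i <;> fin_cases j <;> simp [realBloch]
  · linear_combination (1 / 4) * h'
  · ring
  · ring
  · linear_combination (1 / 4) * h'

theorem realBloch_isPureState {c s : ℝ} (h : c ^ 2 + s ^ 2 = 1) :
    IsPureState (realBloch c s) :=
  ⟨realBloch_isHermitian c s, realBloch_mul_self h, realBloch_trace c s⟩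

theorem IsPureState.isDensityMatrix {d : ℕ} {ρ : Matrix (Fin d) (Fin d) ℂ}
    (h : IsPureState ρ) : IsDensityMatrix ρ := by
  refine ⟨?_, h.2.2⟩
  have := Matrix.posSemidef_conjTranspose_mul_self ρ
  rwa [h.1.eq, h.2.1] at this

theorem realBloch_trace_mul (c s c' s' : ℝ) :
    ((realBloch c s * realBloch c' s').trace).re = (1 + (c * c' + s * s')) / 2 := by
  simp only [realBloch, Matrix.mul_fin_two, Matrix.trace_fin_two_of, ← Complex.ofReal_mul,
    ← Complex.ofReal_add, Complex.ofReal_re]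
  ring

/-- The two antipodal operators `(1 ± (c σ_z + s σ_x)) / 2`. -/
noncomputable def blochPair (c s : ℝ) : Fin 2 → Matrix (Fin 2) (Fin 2) ℂ :=
  ![realBloch c s, realBloch (-c) (-s)]

theorem blochPair_isPureState {c s : ℝ} (h : c ^ 2 + s ^ 2 = 1) (a : Fin 2) :
    IsPureState (blochPair c s a) := by
  fin_cases a
  · exact realBloch_isPureState h
  · exact realBloch_isPureState (by simpa using h)

theorem blochPair_add (c s : ℝ) : blochPair c s 0 + blochPair c s 1 = 1 := by
  ext i j
  fin_cases i <;> fin_cases j <;> simp [blochPair, realBloch] <;> ring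

/-- Outcome statistics of antipodal pairs differ by half the difference of the inner products
of their Bloch vectors. -/
theorem abs_blochPair_trace_sub {c s c' s' k t k' t' : ℝ} (a b : Fin 2) :
    |((blochPair c s a * blochPair c' s' b).trace).re -
      ((blochPair k t a * blochPair k' t' b).trace).re| =
      |(c * c' + s * s') - (k * k' + t * t')| / 2 := by
  rw [← abs_of_pos (two_pos : (0 : ℝ) < 2), ← abs_div, abs_eq_abs]
  fin_cases a <;> fin_cases b <;>
    simp only [blochPair, Fin.zero_eta, Fin.mk_one, Matrix.cons_val_zero, Matrix.cons_val_one,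
      realBloch_trace_mul]
  · left; ring
  · right; ring
  · right; ring
  · left; ring

/-- Appendix A: the overlap-deviation bound of Theorem 1 is saturated to first
order in `√ε`.  For every `0 < ε ≤ 1/2` there are target pure qubit states
(`ρ^1_1 = |θ⟩⟨θ|` with `|θ⟩ = √(1-ε)|0⟩ + √ε|1⟩` and `ρ^2_1 = |+⟩⟨+|`),
experimental states and experimental POVMs whose statistics are `ε`-close to
the target ones, while the state overlap deviates by exactly `√(ε - ε²)`. -/
theorem overlap_bound_saturation (ε : ℝ) (hε0 : 0 < ε) (hε : ε ≤ 1/2) :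
    ∃ (ρ ρt Mt : Fin 2 → Fin 2 → Matrix (Fin 2) (Fin 2) ℂ),
      (∀ x a, IsPureState (ρ x a)) ∧
      (∀ x, ρ x 0 + ρ x 1 = 1) ∧
      ρ 0 0 = !![((1 - ε : ℝ) : ℂ), ((Real.sqrt ((1 - ε) * ε) : ℝ) : ℂ);
                 ((Real.sqrt ((1 - ε) * ε) : ℝ) : ℂ), ((ε : ℝ) : ℂ)] ∧
      ρ 1 0 = !![(1/2 : ℂ), (1/2 : ℂ); (1/2 : ℂ), (1/2 : ℂ)] ∧
      (∀ x a, IsDensityMatrix (ρt x a)) ∧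
      (∀ y b, (Mt y b).PosSemidef) ∧
      (∀ y, Mt y 0 + Mt y 1 = 1) ∧
      (∀ x y a b,
        |((ρt x a * Mt y b).trace).re - ((ρ x a * ρ y b).trace).re| ≤ ε) ∧
      |((ρ 0 0 * ρ 1 0).trace).re - ((ρt 0 0 * ρt 1 0).trace).re|
        = Real.sqrt (ε - ε^2) := by
  set r := Real.sqrt ((1 - ε) * ε) with hr
  have hr2 : r ^ 2 = (1 - ε) * ε := Real.sq_sqrt (by nlinarith)
  have hθ : (1 - 2 * ε) ^ 2 + (2 * r) ^ 2 = 1 := by linear_combination 4 * hr2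
  have hθ' : (2 * r) ^ 2 + (1 - 2 * ε) ^ 2 = 1 := by linear_combination hθ
  have hz : (1 : ℝ) ^ 2 + 0 ^ 2 = 1 := by norm_num
  have hx : (0 : ℝ) ^ 2 + 1 ^ 2 = 1 := by norm_num
  refine ⟨![blochPair (1 - 2 * ε) (2 * r), blochPair 0 1], ![blochPair 1 0, blochPair 0 1],
    ![blochPair (1 - 2 * ε) (2 * r), blochPair (2 * r) (1 - 2 * ε)],
    Fin.forall_fin_two.2 ⟨blochPair_isPureState hθ, blochPair_isPureState hx⟩,
    Fin.forall_fin_two.2 ⟨blochPair_add _ _, blochPair_add _ _⟩, ?_, ?_,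
    Fin.forall_fin_two.2 ⟨fun a => (blochPair_isPureState hz a).isDensityMatrix,
      fun a => (blochPair_isPureState hx a).isDensityMatrix⟩,
    Fin.forall_fin_two.2 ⟨fun b => (blochPair_isPureState hθ b).isDensityMatrix.1,
      fun b => (blochPair_isPureState hθ' b).isDensityMatrix.1⟩,
    Fin.forall_fin_two.2 ⟨blochPair_add _ _, blochPair_add _ _⟩, ?_, ?_⟩
  · simp only [blochPair, realBloch, Matrix.cons_val_zero]
    ext i j
    fin_cases i <;> fin_cases j <;> simp; ring
  · simp [blochPair, realBloch]
  · intro x y a b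
    fin_cases x <;> fin_cases y <;>
      simp only [Fin.zero_eta, Fin.mk_one, Matrix.cons_val_zero, Matrix.cons_val_one,
        abs_blochPair_trace_sub] <;>
      rw [div_le_iff₀ two_pos, abs_le] <;> constructor <;> nlinarith
  · simp only [Matrix.cons_val_zero, Matrix.cons_val_one, abs_blochPair_trace_sub]
    rw [show ε - ε ^ 2 = (1 - ε) * ε by ring, ← hr,
      show (1 - 2 * ε) * 0 + 2 * r * 1 - (1 * 0 + 0 * 1) = 2 * r by ring,
      abs_of_nonneg (by positivity)]
    ring
end
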